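/- Let Λ and Λ' be finite alphabets, Ω = (Λ×Λ')^ℤ with the shift T, and μ a shift-invariant weak mixing probability measure on Ω. Let α ∈ (0,1) be irrational and fix finite words a over Λ and b over Λ'. For t ∈ [0,1) and k ≥ 1 let 𝓗_{t,k} = 𝓕_{−l_k(t)+1}^{s_k(t)} ∨ 𝓖_{−l_k(t)+1}^0, and define (for any fixed versions of the conditional expectations) F_{t,k} = E[ (𝟙_{Ā} ∘ T^{s_k(t)}) · 𝟙_{B̄} | 𝓗_{t,k} ] and C_{t,k} = E[ 𝟙_{Ā} ∘ T^{s_k(t)} | 𝓗_{t,k} ] · E[ 𝟙_{B̄} | 𝓗_{t,k} ]. Then there is a set Ω' ⊆ Ω of full μ-measure such that for all ω ∈ Ω' and all t ∈ [0,1): (1/N) ∑_{k=1}^N | F_{t,k}(T^{l_k(t)} ω) − C_{t,k}(T^{l_k(t)} ω) | → 0 as N → ∞. -/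

import Mathlib

open MeasureTheory Filter Topology

/-- A probability measure-preserving system `(Ω, μ, T)` is weak mixing if the product
system `(Ω × Ω, μ × μ, T × T)` is ergodic. -/
def WeakMixing {Ω : Type*} [MeasurableSpace Ω] (T : Ω → Ω) (μ : MeasureTheory.Measure Ω) : Prop :=
  Ergodic (Prod.map T T) (μ.prod μ)

/-- The two-sided shift on sequences. -/
def shiftZ {A : Type*} (ω : ℤ → A) : ℤ → A := fun k => ω (k + 1)

/-- `l_k(t) = ⌊t + α k⌋` (as a natural number). -/
noncomputable def lk (α t : ℝ) (k : ℕ) : ℕ := (⌊t + α * k⌋).toNat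

/-- `s_k(t) = k - l_k(t)`. -/
noncomputable def sk (α t : ℝ) (k : ℕ) : ℕ := k - lk α t k

/-- The σ-algebra `𝓕_S` on `(Λ × Λ')^ℤ` generated by the first coordinates `ω¹_r`, `r ∈ S`. -/
def FalgZ {Λ Λ' : Type*} [MeasurableSpace Λ] (S : Set ℤ) :
    MeasurableSpace (ℤ → Λ × Λ') :=
  ⨆ r ∈ S, MeasurableSpace.comap (fun ω : ℤ → Λ × Λ' => (ω r).1) inferInstance

/-- The σ-algebra `𝓖_S` on `(Λ × Λ')^ℤ` generated by the second coordinates `ω²_r`, `r ∈ S`. -/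
def GalgZ {Λ Λ' : Type*} [MeasurableSpace Λ'] (S : Set ℤ) :
    MeasurableSpace (ℤ → Λ × Λ') :=
  ⨆ r ∈ S, MeasurableSpace.comap (fun ω : ℤ → Λ × Λ' => (ω r).2) inferInstance

/-- `Ā = {ω : ω¹_1 … ω¹_{|a|} = a}`. -/
def AbarZ {Λ Λ' : Type*} (a : List Λ) : Set (ℤ → Λ × Λ') :=
  {ω | ∀ j : Fin a.length, (ω ((j : ℕ) + 1 : ℤ)).1 = a.get j}

/-- `B̄ = {ω : ω²_1 … ω²_{|b|} = b}`. -/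
def BbarZ {Λ Λ' : Type*} (b : List Λ') : Set (ℤ → Λ × Λ') :=
  {ω | ∀ j : Fin b.length, (ω ((j : ℕ) + 1 : ℤ)).2 = b.get j}

/-- The σ-algebra `𝓗_{t,k} = 𝓕_{-l_k(t)+1}^{s_k(t)} ∨ 𝓖_{-l_k(t)+1}^0`. -/
noncomputable def Htk {Λ Λ' : Type*} [MeasurableSpace Λ] [MeasurableSpace Λ']
    (α t : ℝ) (k : ℕ) : MeasurableSpace (ℤ → Λ × Λ') :=
  FalgZ (Set.Icc (-(lk α t k : ℤ) + 1) (sk α t k : ℤ)) ⊔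
    GalgZ (Set.Icc (-(lk α t k : ℤ) + 1) 0)

/-- `F_{t,k} = E[ (𝟙_Ā ∘ T^{s_k(t)}) · 𝟙_B̄ | 𝓗_{t,k} ]`. -/
noncomputable def Ftk {Λ Λ' : Type*} [MeasurableSpace Λ] [MeasurableSpace Λ']
    (μ : MeasureTheory.Measure (ℤ → Λ × Λ')) (α t : ℝ) (k : ℕ)
    (a : List Λ) (b : List Λ') : (ℤ → Λ × Λ') → ℝ :=
  μ[fun ω => Set.indicator (AbarZ a) (1 : (ℤ → Λ × Λ') → ℝ) (shiftZ^[sk α t k] ω) *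
      Set.indicator (BbarZ b) (1 : (ℤ → Λ × Λ') → ℝ) ω | Htk α t k]

/-- `C_{t,k} = E[ 𝟙_Ā ∘ T^{s_k(t)} | 𝓗_{t,k} ] · E[ 𝟙_B̄ | 𝓗_{t,k} ]`. -/
noncomputable def Ctk {Λ Λ' : Type*} [MeasurableSpace Λ] [MeasurableSpace Λ']
    (μ : MeasureTheory.Measure (ℤ → Λ × Λ')) (α t : ℝ) (k : ℕ)
    (a : List Λ) (b : List Λ') : (ℤ → Λ × Λ') → ℝ :=
  fun ω =>
    (μ[fun ω' => Set.indicator (AbarZ a) (1 : (ℤ → Λ × Λ') → ℝ) (shiftZ^[sk α t k] ω') |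
        Htk α t k]) ω *
      (μ[Set.indicator (BbarZ b) (1 : (ℤ → Λ × Λ') → ℝ) | Htk α t k]) ω


section MaximalErgodic

variable {Ω : Type*} {T : Ω → Ω}

/-- The maximum over `0 ≤ n ≤ N` of the Birkhoff sums `∑ j < n, f ∘ T^j`. -/
def maxBirkhoff (T : Ω → Ω) (f : Ω → ℝ) : ℕ → Ω → ℝ
  | 0 => 0
  | N + 1 => fun ω => max 0 (f ω + maxBirkhoff T f N (T ω))

lemma maxBirkhoff_nonneg (f : Ω → ℝ) (N : ℕ) (ω : Ω) : 0 ≤ maxBirkhoff T f N ω := by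
  cases N with
  | zero => exact le_rfl
  | succ N => exact le_max_left _ _

lemma maxBirkhoff_mono (f : Ω → ℝ) (N : ℕ) (ω : Ω) :
    maxBirkhoff T f N ω ≤ maxBirkhoff T f (N + 1) ω := by
  induction N generalizing ω with
  | zero => exact le_max_left _ _
  | succ N ih => exact max_le_max le_rfl (add_le_add le_rfl (ih _))

lemma birkhoffSum_le_maxBirkhoff (f : Ω → ℝ) (N : ℕ) (ω : Ω) :
    birkhoffSum T f N ω ≤ maxBirkhoff T f N ω := by
  induction N generalizing ω with
  | zero => simp [maxBirkhoff]
  | succ N ih =>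
    rw [birkhoffSum_succ']
    exact (add_le_add le_rfl (ih _)).trans (le_max_right _ _)

variable [MeasurableSpace Ω] {μ : Measure Ω}

lemma integrable_maxBirkhoff (hT : MeasurePreserving T μ μ) {f : Ω → ℝ} (hf : Integrable f μ)
    (N : ℕ) : Integrable (maxBirkhoff T f N) μ := by
  induction N with
  | zero => exact integrable_zero _ _ _
  | succ N ih => exact (integrable_zero _ _ _).sup (hf.add (hT.integrable_comp_of_integrable ih))

lemma measurable_maxBirkhoff (hT : Measurable T) {f : Ω → ℝ} (hf : Measurable f)
    (N : ℕ) : Measurable (maxBirkhoff T f N) := by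
  induction N with
  | zero => exact measurable_const
  | succ N ih => exact measurable_const.max (hf.add (ih.comp hT))

/-- Garsia's form of the maximal ergodic theorem. -/
lemma setIntegral_maxBirkhoff_pos_nonneg (hT : MeasurePreserving T μ μ) {f : Ω → ℝ}
    (hfm : Measurable f) (hf : Integrable f μ) (N : ℕ) :
    0 ≤ ∫ ω in {ω | 0 < maxBirkhoff T f N ω}, f ω ∂μ := by
  set M := maxBirkhoff T f N with hM
  have hMm : Measurable M := measurable_maxBirkhoff hT.measurable hfm N
  have hMi : Integrable M μ := integrable_maxBirkhoff hT hf N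
  have hMT : Integrable (fun ω => M (T ω)) μ := hT.integrable_comp_of_integrable hMi
  have hE : MeasurableSet {ω | 0 < M ω} := measurableSet_lt measurable_const hMm
  have h0 : ∫ ω, (M ω - M (T ω)) ∂μ = 0 := by
    have h1 : ∫ ω, M (T ω) ∂μ = ∫ ω, M ω ∂μ := by
      rw [← integral_map hT.aemeasurable (by rw [hT.map_eq]; exact hMi.aestronglyMeasurable),
        hT.map_eq]
    rw [integral_sub hMi hMT, h1, sub_self]
  rw [← integral_indicator hE]
  refine h0.symm.le.trans ?_
  refine integral_mono (hMi.sub hMT) (hf.indicator hE) fun ω => ?_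
  by_cases hω : 0 < M ω
  · rw [Set.indicator_of_mem (show ω ∈ {ω | 0 < M ω} from hω)]
    cases N with
    | zero => exact absurd hω (lt_irrefl _)
    | succ N =>
      have h1 : M ω = max 0 (f ω + maxBirkhoff T f N (T ω)) := rfl
      have h2 : maxBirkhoff T f N (T ω) ≤ M (T ω) := maxBirkhoff_mono f N (T ω)
      have h3 : M ω ≤ f ω + maxBirkhoff T f N (T ω) := by
        rcases max_choice 0 (f ω + maxBirkhoff T f N (T ω)) with h | h
        · rw [h] at h1; exact absurd hω (by rw [h1]; exact lt_irrefl _)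
        · exact (h1.trans h).le
      show M ω - M (T ω) ≤ f ω
      linarith
  · rw [Set.indicator_of_notMem (show ω ∉ {ω | 0 < M ω} from hω)]
    have h1 : 0 ≤ M (T ω) := maxBirkhoff_nonneg f N (T ω)
    show M ω - M (T ω) ≤ 0
    linarith [not_lt.mp hω]

/-- Weak-type maximal inequality for ergodic averages. -/
lemma measure_exists_birkhoffSum_gt_le [IsProbabilityMeasure μ]
    (hT : MeasurePreserving T μ μ) {g : Ω → ℝ}
    (hgm : Measurable g) (hg : Integrable g μ) (hg0 : 0 ≤ g) {ε : ℝ} (hε : 0 < ε) :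
    μ {ω | ∃ n : ℕ, ε * n < birkhoffSum T g n ω} ≤ ENNReal.ofReal ((∫ ω, g ω ∂μ) / ε) := by
  set f : Ω → ℝ := fun ω => g ω - ε with hf
  have hfm : Measurable f := hgm.sub measurable_const
  have hfi : Integrable f μ := hg.sub (integrable_const _)
  have hS : ∀ n ω, birkhoffSum T f n ω = birkhoffSum T g n ω - ε * n := by
    intro n ω
    simp [birkhoffSum, hf, Finset.sum_sub_distrib, mul_comm]
  have hN : ∀ N, μ {ω | 0 < maxBirkhoff T f N ω} ≤ ENNReal.ofReal ((∫ ω, g ω ∂μ) / ε) := by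
    intro N
    have hE : MeasurableSet {ω | 0 < maxBirkhoff T f N ω} :=
      measurableSet_lt measurable_const (measurable_maxBirkhoff hT.measurable hfm N)
    have h := setIntegral_maxBirkhoff_pos_nonneg hT hfm hfi N
    rw [hf, integral_sub hg.integrableOn (integrable_const _), setIntegral_const, smul_eq_mul,
      ← hf] at h
    have h2 := setIntegral_le_integral (s := {ω | 0 < maxBirkhoff T f N ω}) hg (.of_forall hg0)
    rw [← ofReal_measureReal]
    refine ENNReal.ofReal_le_ofReal ?_
    rw [le_div_iff₀ hε]
    linarith
  have hmono : Monotone fun N => {ω | 0 < maxBirkhoff T f N ω} :=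
    monotone_nat_of_le_succ fun N ω hω => lt_of_lt_of_le hω (maxBirkhoff_mono f N ω)
  calc _ ≤ μ (⋃ N, {ω | 0 < maxBirkhoff T f N ω}) := by
        refine measure_mono ?_
        rintro ω ⟨n, hn⟩
        refine Set.mem_iUnion.2 ⟨n, lt_of_lt_of_le ?_ (birkhoffSum_le_maxBirkhoff f n ω)⟩
        rw [hS]; linarith
    _ ≤ _ := by
        rw [hmono.measure_iUnion]
        exact iSup_le hN

end MaximalErgodic

section Maker

variable {Ω : Type*} [MeasurableSpace Ω] {μ : Measure Ω} [IsProbabilityMeasure μ]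

/-- A bounded sequence converging to `0` almost everywhere has tail majorants whose integrals
tend to `0`. -/
lemma exists_tail_majorant {Z : ℕ → Ω → ℝ} {R : ℝ} (hZm : ∀ k, Measurable (Z k))
    (hZ0 : ∀ k ω, 0 ≤ Z k ω) (hZR : ∀ k, ∀ᵐ ω ∂μ, Z k ω ≤ R)
    (hZ : ∀ᵐ ω ∂μ, Tendsto (fun k => Z k ω) atTop (𝓝 0)) :
    ∃ Y : ℕ → Ω → ℝ, (∀ m, Measurable (Y m)) ∧ (∀ m, Integrable (Y m) μ) ∧
      (∀ m ω, 0 ≤ Y m ω) ∧ (∀ᵐ ω ∂μ, ∀ m k, m ≤ k → Z k ω ≤ Y m ω) ∧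
      Tendsto (fun m => ∫ ω, Y m ω ∂μ) atTop (𝓝 0) := by
  have hR : 0 ≤ R := by
    obtain ⟨ω, hω⟩ := (hZR 0).exists
    exact (hZ0 0 ω).trans hω
  have hbdd : ∀ m ω, BddAbove (Set.range fun k => min (Z (m + k) ω) R) := fun m ω =>
    ⟨R, by rintro _ ⟨k, rfl⟩; exact min_le_right _ _⟩
  set Y : ℕ → Ω → ℝ := fun m ω => ⨆ k, min (Z (m + k) ω) R with hY
  have hYm : ∀ m, Measurable (Y m) := fun m =>
    Measurable.iSup fun k => (hZm _).min measurable_const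
  have hY0 : ∀ m ω, 0 ≤ Y m ω := fun m ω =>
    (le_min (hZ0 _ ω) hR).trans (le_ciSup (hbdd m ω) 0)
  have hYR : ∀ m ω, Y m ω ≤ R := fun m ω => ciSup_le fun k => min_le_right _ _
  have hYb : ∀ m ω, ‖Y m ω‖ ≤ R := fun m ω => by
    rw [Real.norm_of_nonneg (hY0 m ω)]; exact hYR m ω
  refine ⟨Y, hYm, fun m => .of_bound (hYm m).aestronglyMeasurable R (.of_forall (hYb m)), hY0,
    ?_, ?_⟩
  · filter_upwards [ae_all_iff.2 hZR] with ω hω m k hmk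
    have := le_ciSup (hbdd m ω) (k - m)
    rwa [Nat.add_sub_cancel' hmk, min_eq_left (hω k)] at this
  · rw [← integral_zero Ω ℝ (μ := μ)]
    refine tendsto_integral_of_dominated_convergence (fun _ => R)
      (fun m => (hYm m).aestronglyMeasurable) (integrable_const _)
      (fun m => .of_forall (hYb m)) ?_
    filter_upwards [hZ] with ω hω
    rw [Metric.tendsto_atTop] at hω ⊢
    intro ε hε
    obtain ⟨K, hK⟩ := hω (ε / 2) (half_pos hε)
    refine ⟨K, fun m hm => ?_⟩
    rw [dist_zero_right, Real.norm_of_nonneg (hY0 m ω)]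
    refine lt_of_le_of_lt (ciSup_le fun k => ?_) (half_lt_self hε)
    have := hK (m + k) (by omega)
    rw [dist_zero_right] at this
    exact (min_le_left _ _).trans ((le_abs_self _).trans this.le)

/-- A variant of Maker's ergodic theorem: if `D k → 0` almost everywhere boundedly, then
the averages of `D k ∘ T^[l k]` tend to `0` almost everywhere, provided that `l` takes each value
boundedly often and grows at most linearly. -/
lemma tendsto_average_comp_iterate {T : Ω → Ω} (hT : MeasurePreserving T μ μ)
    {D : ℕ → Ω → ℝ} {R : ℝ} (hDm : ∀ k, Measurable (D k))
    (hD0 : ∀ k ω, 0 ≤ D k ω) (hDR : ∀ k, ∀ᵐ ω ∂μ, D k ω ≤ R)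
    (hD : ∀ᵐ ω ∂μ, Tendsto (fun k => D k ω) atTop (𝓝 0))
    {l : ℕ → ℕ} (hl : ∀ k, l k ≤ k + 1) {M : ℕ}
    (hM : ∀ N j, ((Finset.Icc 1 N).filter fun k => l k = j).card ≤ M) :
    ∀ᵐ ω ∂μ, Tendsto (fun N : ℕ => (N : ℝ)⁻¹ * ∑ k ∈ Finset.Icc 1 N, D k (T^[l k] ω))
      atTop (𝓝 0) := by
  obtain ⟨Y, hYm, hYi, hY0, hDY, hY⟩ := exists_tail_majorant hDm hD0 hDR hD
  have hmax : ∀ ε : ℝ, 0 < ε → ∀ᵐ ω ∂μ, ∃ m, ∀ n : ℕ, birkhoffSum T (Y m) n ω ≤ ε * n := by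
    intro ε hε
    have hle : ∀ m, μ {ω | ¬ ∃ m, ∀ n : ℕ, birkhoffSum T (Y m) n ω ≤ ε * n} ≤
        ENNReal.ofReal ((∫ ω, Y m ω ∂μ) / ε) := by
      intro m
      refine (measure_mono ?_).trans
        (measure_exists_birkhoffSum_gt_le hT (hYm m) (hYi m) (hY0 m) hε)
      intro ω hω
      simp only [Set.mem_ofPred_eq, not_exists, not_forall, not_le] at hω
      exact hω m
    have hlim : Tendsto (fun m => ENNReal.ofReal ((∫ ω, Y m ω ∂μ) / ε)) atTop (𝓝 0) := by
      simpa using ENNReal.tendsto_ofReal (hY.div_const ε)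
    exact le_antisymm (ge_of_tendsto' hlim hle) zero_le
  have hmax' : ∀ᵐ ω ∂μ, ∀ i : ℕ, ∃ m, ∀ n : ℕ,
      birkhoffSum T (Y m) n ω ≤ (1 / ((i : ℝ) + 1)) * n :=
    ae_all_iff.2 fun i => hmax _ Nat.one_div_pos_of_nat
  have horb : ∀ᵐ ω ∂μ, ∀ j : ℕ, (∀ m k, m ≤ k → D k (T^[j] ω) ≤ Y m (T^[j] ω)) ∧
      ∀ k, D k (T^[j] ω) ≤ R :=
    ae_all_iff.2 fun j => (hT.iterate j).quasiMeasurePreserving.ae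
      (hDY.and (ae_all_iff.2 hDR))
  filter_upwards [hmax', horb] with ω hω1 hω2
  have hR : 0 ≤ R := (hD0 0 _).trans ((hω2 0).2 0)
  have key : ∀ i : ℕ, ∃ m : ℕ, ∀ N : ℕ, ∑ k ∈ Finset.Icc 1 N, D k (T^[l k] ω) ≤
      m * R + M * ((1 / ((i : ℝ) + 1)) * (N + 2)) := by
    intro i
    obtain ⟨m, hm⟩ := hω1 i
    refine ⟨m, fun N => ?_⟩
    have hpt : ∀ k ∈ Finset.Icc 1 N, D k (T^[l k] ω) ≤
        (if k < m then R else 0) + Y m (T^[l k] ω) := by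
      intro k _
      split_ifs with hk
      · exact ((hω2 (l k)).2 k).trans (le_add_of_nonneg_right (hY0 m _))
      · rw [zero_add]; exact (hω2 (l k)).1 m k (not_lt.mp hk)
    refine (Finset.sum_le_sum hpt).trans ?_
    rw [Finset.sum_add_distrib]
    refine add_le_add ?_ ?_
    · rw [← Finset.sum_filter, Finset.sum_const, nsmul_eq_mul]
      refine mul_le_mul_of_nonneg_right ?_ hR
      have : ((Finset.Icc 1 N).filter (· < m)) ⊆ Finset.range m := by
        intro k hk
        simpa using (Finset.mem_filter.1 hk).2
      simpa using (Finset.card_le_card this)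
    · have hmaps : ∀ k ∈ Finset.Icc 1 N, l k ∈ Finset.range (N + 2) := by
        intro k hk
        have := hl k
        have := (Finset.mem_Icc.1 hk).2
        rw [Finset.mem_range]; omega
      rw [← Finset.sum_fiberwise_of_maps_to hmaps]
      calc _ ≤ ∑ j ∈ Finset.range (N + 2), (M : ℝ) * Y m (T^[j] ω) := by
            refine Finset.sum_le_sum fun j _ => ?_
            rw [Finset.sum_congr rfl fun k hk => by rw [(Finset.mem_filter.1 hk).2],
              Finset.sum_const, nsmul_eq_mul]
            exact mul_le_mul_of_nonneg_right (by exact_mod_cast hM N j) (hY0 _ _)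
        _ = M * birkhoffSum T (Y m) (N + 2) ω := by rw [← Finset.mul_sum]; rfl
        _ ≤ _ := by
            refine mul_le_mul_of_nonneg_left ?_ (Nat.cast_nonneg _)
            exact_mod_cast hm (N + 2)
  have hnn : ∀ N : ℕ, 0 ≤ (N : ℝ)⁻¹ * ∑ k ∈ Finset.Icc 1 N, D k (T^[l k] ω) := fun N =>
    mul_nonneg (by positivity) (Finset.sum_nonneg fun k _ => hD0 _ _)
  have hi : Tendsto (fun i : ℕ => (M : ℝ) * (1 / ((i : ℝ) + 1))) atTop (𝓝 0) := by
    simpa using (tendsto_one_div_add_atTop_nhds_zero_nat (𝕜 := ℝ)).const_mul (M : ℝ)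
  rw [Metric.tendsto_atTop]
  intro ε hε
  obtain ⟨i, hi⟩ := (hi.eventually_lt_const hε).exists
  obtain ⟨m, hm⟩ := key i
  have hlim : Tendsto (fun N : ℕ => ((m : ℝ) * R + 2 * (M * (1 / ((i : ℝ) + 1)))) * (N : ℝ)⁻¹ +
      M * (1 / ((i : ℝ) + 1))) atTop (𝓝 (M * (1 / ((i : ℝ) + 1)))) := by
    simpa using ((tendsto_inv_atTop_nhds_zero_nat (𝕜 := ℝ)).const_mul
      ((m : ℝ) * R + 2 * (M * (1 / ((i : ℝ) + 1))))).add_const (M * (1 / ((i : ℝ) + 1)))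
  obtain ⟨N₀, hN₀⟩ := eventually_atTop.1
    ((hlim.eventually_lt_const hi).and (eventually_gt_atTop 0))
  refine ⟨N₀, fun N hN => ?_⟩
  obtain ⟨h1, h2⟩ := hN₀ N hN
  rw [dist_zero_right, Real.norm_of_nonneg (hnn N)]
  refine lt_of_le_of_lt ?_ h1
  have hNpos : (0 : ℝ) < N := by exact_mod_cast h2
  refine (mul_le_mul_of_nonneg_left (hm N) (by positivity)).trans (le_of_eq ?_)
  field_simp
  ring

end Maker

section CondExp

variable {Ω : Type*} [m0 : MeasurableSpace Ω] {μ : Measure Ω}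

lemma abs_condExp_le_one {m : MeasurableSpace Ω} {f : Ω → ℝ} (hf : ∀ ω, |f ω| ≤ 1) :
    ∀ᵐ ω ∂μ, |(μ[f | m]) ω| ≤ 1 :=
  ae_bdd_abs_condExp_of_ae_bdd_abs (.of_forall hf)

variable [IsProbabilityMeasure μ]

/-- **Hunt's lemma** for bounded sequences converging to `0`. -/
lemma tendsto_ae_condExp_of_tendsto_zero (ℱ : Filtration ℕ m0) {Z : ℕ → Ω → ℝ} {R : ℝ}
    (hZm : ∀ k, Measurable (Z k)) (hZ0 : ∀ k ω, 0 ≤ Z k ω) (hZR : ∀ k, ∀ᵐ ω ∂μ, Z k ω ≤ R)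
    (hZ : ∀ᵐ ω ∂μ, Tendsto (fun k => Z k ω) atTop (𝓝 0)) :
    ∀ᵐ ω ∂μ, Tendsto (fun k => (μ[Z k | ℱ k]) ω) atTop (𝓝 0) := by
  obtain ⟨Y, hYm, hYi, hY0, hZY, hY⟩ := exists_tail_majorant hZm hZ0 hZR hZ
  have hZi : ∀ k, Integrable (Z k) μ := fun k =>
    .of_bound (hZm k).aestronglyMeasurable R <| by
      filter_upwards [hZR k] with ω hω
      rwa [Real.norm_of_nonneg (hZ0 k ω)]
  have hle : ⨆ n, ℱ n ≤ m0 := iSup_le fun n => ℱ.le n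
  set V : ℕ → Ω → ℝ := fun m => μ[Y m | ⨆ n, ℱ n] with hV
  have hVm : ∀ m, Measurable (V m) := fun m =>
    (stronglyMeasurable_condExp.mono hle).measurable
  have hV0 : ∀ m, 0 ≤ᵐ[μ] V m := fun m => condExp_nonneg (.of_forall (hY0 m))
  have hVlim : ∀ᵐ ω ∂μ, liminf (fun m => ENNReal.ofReal (V m ω)) atTop = 0 := by
    have h1 : ∫⁻ ω, liminf (fun m => ENNReal.ofReal (V m ω)) atTop ∂μ = 0 := by
      refine le_antisymm ((lintegral_liminf_le fun m => (hVm m).ennreal_ofReal).trans ?_) zero_le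
      have h2 : ∀ m, ∫⁻ ω, ENNReal.ofReal (V m ω) ∂μ = ENNReal.ofReal (∫ ω, Y m ω ∂μ) := by
        intro m
        rw [← ofReal_integral_eq_lintegral_ofReal integrable_condExp (hV0 m),
          integral_condExp hle]
      simp_rw [h2]
      have h3 : Tendsto (fun m => ENNReal.ofReal (∫ ω, Y m ω ∂μ)) atTop (𝓝 0) := by
        simpa using ENNReal.tendsto_ofReal hY
      exact h3.liminf_eq.le
    exact (lintegral_eq_zero_iff (.liminf fun m => (hVm m).ennreal_ofReal)).1 h1
  have hmono : ∀ᵐ ω ∂μ, ∀ m k, m ≤ k → (μ[Z k | ℱ k]) ω ≤ (μ[Y m | ℱ k]) ω := by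
    refine ae_all_iff.2 fun m => ae_all_iff.2 fun k => ?_
    by_cases hmk : m ≤ k
    · filter_upwards [condExp_mono (m := ℱ k) (hZi k) (hYi m)
        (hZY.mono fun ω hω => hω m k hmk)] with ω hω _ using hω
    · exact .of_forall fun ω h => absurd h hmk
  filter_upwards [hVlim, hmono, ae_all_iff.2 fun m => tendsto_ae_condExp (ℱ := ℱ) (μ := μ) (Y m),
    ae_all_iff.2 fun k => condExp_nonneg (m := ℱ k) (μ := μ) (f := Z k) (.of_forall (hZ0 k))]
    with ω h1 h2 h3 h4
  rw [Metric.tendsto_nhds]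
  intro ε hε
  have hfreq : ∃ m, ENNReal.ofReal (V m ω) < ENNReal.ofReal ε := by
    by_contra! hcon
    have := le_liminf_of_le (f := atTop) (by isBoundedDefault) (Eventually.of_forall hcon)
    rw [h1] at this
    simp at this
    linarith
  obtain ⟨m, hm⟩ := hfreq
  have hm' : V m ω < ε := (ENNReal.ofReal_lt_ofReal_iff hε).1 hm
  filter_upwards [(h3 m).eventually_lt_const hm', eventually_ge_atTop m] with k hk hmk
  rw [dist_zero_right, Real.norm_of_nonneg (h4 k)]
  exact (h2 m k hmk).trans_lt hk

/-- The conditional covariance of `f` and `g` given `m` is controlled by how much the conditional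
expectation of `g` changes when `m` is enlarged so as to make `f` measurable. -/
lemma abs_condExp_mul_sub_le {m m' : MeasurableSpace Ω} (hmm' : m ≤ m') (hm' : m' ≤ m0)
    {f g : Ω → ℝ} (hf : StronglyMeasurable[m'] f) (hf1 : ∀ ω, |f ω| ≤ 1) (hg : Integrable g μ) :
    ∀ᵐ ω ∂μ, |(μ[f * g | m]) ω - (μ[f | m]) ω * (μ[g | m]) ω| ≤
      (μ[fun ω => |(μ[g | m']) ω - (μ[g | m]) ω| | m]) ω := by
  have hm : m ≤ m0 := hmm'.trans hm'
  have hfm : AEStronglyMeasurable[m0] f μ := (hf.mono hm').aestronglyMeasurable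
  have hf1' : ∀ᵐ ω ∂μ, ‖f ω‖ ≤ 1 := .of_forall hf1
  have hfi : Integrable f μ := .of_bound hfm 1 hf1'
  have hfmul : ∀ {h : Ω → ℝ}, Integrable h μ → Integrable (f * h) μ :=
    fun hh => hh.bdd_mul hfm hf1'
  set d : Ω → ℝ := μ[g | m'] - μ[g | m] with hd
  have hdi : Integrable d μ := integrable_condExp.sub integrable_condExp
  have h1 : μ[f * g | m] =ᵐ[μ] μ[f * μ[g | m'] | m] :=
    (condExp_condExp_of_le hmm' hm').symm.trans
      (condExp_congr_ae (condExp_mul_of_stronglyMeasurable_left hf (hfmul hg) hg))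
  have h2 : μ[f * μ[g | m] | m] =ᵐ[μ] μ[f | m] * μ[g | m] :=
    condExp_mul_of_stronglyMeasurable_right stronglyMeasurable_condExp
      (hfmul integrable_condExp) hfi
  have h3 : μ[f * d | m] =ᵐ[μ] μ[f * μ[g | m'] | m] - μ[f * μ[g | m] | m] := by
    rw [hd, mul_sub]
    exact condExp_sub (hfmul integrable_condExp) (hfmul integrable_condExp) m
  have h4 : μ[|f * d| | m] ≤ᵐ[μ] μ[|d| | m] := by
    refine condExp_mono (hfmul hdi).abs hdi.abs (.of_forall fun ω => ?_)
    simp only [Pi.abs_apply, Pi.mul_apply, abs_mul]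
    exact mul_le_of_le_one_left (abs_nonneg _) (hf1 ω)
  filter_upwards [h1, h2, h3, h4, abs_condExp_ae_le_condExp_abs (m := m) (μ := μ) (f * d)]
    with ω e1 e2 e3 e4 e5
  simp only [Pi.abs_apply, Pi.mul_apply, Pi.sub_apply] at e2 e3 e5
  rw [e1, ← e2, ← e3]
  exact e5.trans e4

/-- Asymptotic conditional decorrelation along two cofinal filtrations. -/
lemma tendsto_condExp_mul_sub (ℱ 𝒢 : Filtration ℕ m0) (hle : ∀ k, ℱ k ≤ 𝒢 k)
    (hsup : ⨆ k, ℱ k = ⨆ k, 𝒢 k) {f : ℕ → Ω → ℝ} {g : Ω → ℝ}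
    (hf : ∀ k, StronglyMeasurable[𝒢 k] (f k)) (hf1 : ∀ k ω, |f k ω| ≤ 1)
    (hg : Measurable g) (hg1 : ∀ ω, |g ω| ≤ 1) :
    ∀ᵐ ω ∂μ, Tendsto
      (fun k => |(μ[f k * g | ℱ k]) ω - (μ[f k | ℱ k]) ω * (μ[g | ℱ k]) ω|) atTop (𝓝 0) := by
  have hgi : Integrable g μ := .of_bound hg.aestronglyMeasurable 1 (.of_forall hg1)
  set Z : ℕ → Ω → ℝ := fun k ω => |(μ[g | 𝒢 k]) ω - (μ[g | ℱ k]) ω| with hZ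
  have hZm : ∀ k, Measurable (Z k) := fun k =>
    (((stronglyMeasurable_condExp.mono (𝒢.le k)).measurable).sub
      ((stronglyMeasurable_condExp.mono (ℱ.le k)).measurable)).abs
  have hZR : ∀ k, ∀ᵐ ω ∂μ, Z k ω ≤ 2 := fun k => by
    filter_upwards [abs_condExp_le_one (m := 𝒢 k) (μ := μ) hg1,
      abs_condExp_le_one (m := ℱ k) (μ := μ) hg1] with ω h1 h2
    have := abs_sub ((μ[g | 𝒢 k]) ω) ((μ[g | ℱ k]) ω)
    simp only [hZ]
    linarith
  have hZlim : ∀ᵐ ω ∂μ, Tendsto (fun k => Z k ω) atTop (𝓝 0) := by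
    filter_upwards [tendsto_ae_condExp (ℱ := ℱ) (μ := μ) g,
      tendsto_ae_condExp (ℱ := 𝒢) (μ := μ) g] with ω h1 h2
    rw [hsup] at h1
    simpa using (h2.sub h1).abs
  filter_upwards [tendsto_ae_condExp_of_tendsto_zero ℱ hZm (fun k ω => abs_nonneg _) hZR hZlim,
    ae_all_iff.2 fun k => abs_condExp_mul_sub_le (μ := μ) (hle k) (𝒢.le k) (hf k) (hf1 k) hgi]
    with ω h1 h2
  exact squeeze_zero (fun k => abs_nonneg _) h2 h1

end CondExp

section Symbolic

variable {Λ Λ' : Type*}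

lemma lk_eq_floor (α t : ℝ) (k : ℕ) : lk α t k = ⌊t + α * k⌋₊ := Int.floor_toNat _

lemma lk_mono {α : ℝ} (hα : 0 ≤ α) (t : ℝ) : Monotone (lk α t) := fun i j hij => by
  rw [lk_eq_floor, lk_eq_floor]
  gcongr

lemma lk_le {α t : ℝ} (hα1 : α ≤ 1) (ht1 : t ≤ 1) (k : ℕ) : lk α t k ≤ k + 1 := by
  rw [lk_eq_floor]
  refine Nat.floor_le_of_le ?_
  push_cast
  nlinarith [(Nat.cast_nonneg k : (0 : ℝ) ≤ k)]

lemma lk_succ_le {α t : ℝ} (hα : 0 ≤ α) (hα1 : α ≤ 1) (ht : 0 ≤ t) (k : ℕ) :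
    lk α t (k + 1) ≤ lk α t k + 1 := by
  rw [lk_eq_floor, lk_eq_floor, ← Nat.floor_add_one (by positivity)]
  refine Nat.floor_le_floor ?_
  push_cast
  linarith

lemma sk_mono {α t : ℝ} (hα : 0 ≤ α) (hα1 : α ≤ 1) (ht : 0 ≤ t) : Monotone (sk α t) :=
  monotone_nat_of_le_succ fun k => by
    have := lk_succ_le hα hα1 ht k
    unfold sk
    omega

lemma tendsto_sk {α t : ℝ} (hα : 0 ≤ α) (hα1 : α < 1) (ht : 0 ≤ t) :
    Tendsto (sk α t) atTop atTop := by
  refine (tendsto_natCast_atTop_iff (R := ℝ)).1 ?_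
  have h : Tendsto (fun k : ℕ => (1 - α) * (k : ℝ) - t) atTop atTop :=
    tendsto_atTop_add_const_right _ _
      (tendsto_natCast_atTop_atTop.const_mul_atTop (sub_pos.2 hα1))
  refine tendsto_atTop_mono (fun k => ?_) h
  have h1 : (lk α t k : ℝ) ≤ t + α * k := by
    rw [lk_eq_floor]; exact Nat.floor_le (by positivity)
  have h2 : (k : ℝ) - lk α t k ≤ sk α t k := by
    rw [sub_le_iff_le_add]
    have : k ≤ sk α t k + lk α t k := by unfold sk; omega
    exact_mod_cast this
  linarith

lemma card_lk_fiber_le {α t : ℝ} (hα : 0 < α) (ht : 0 ≤ t) (N j : ℕ) :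
    ((Finset.Icc 1 N).filter fun k => lk α t k = j).card ≤ ⌈α⁻¹⌉₊ := by
  set S := (Finset.Icc 1 N).filter fun k => lk α t k = j with hS
  rcases S.eq_empty_or_nonempty with h | h
  · simp [h]
  · have hsub : S ⊆ Finset.Ico (S.min' h) (S.min' h + ⌈α⁻¹⌉₊) := by
      intro k hk
      refine Finset.mem_Ico.2 ⟨S.min'_le k hk, ?_⟩
      by_contra! hcon
      set i := S.min' h
      have hi : lk α t i = j := (Finset.mem_filter.1 (S.min'_mem h)).2
      have hk' : lk α t k = j := (Finset.mem_filter.1 hk).2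
      have h1 : lk α t i + 1 ≤ lk α t k := by
        rw [lk_eq_floor, lk_eq_floor, ← Nat.floor_add_one (by positivity)]
        refine Nat.floor_le_floor ?_
        have h2 : (i : ℝ) + α⁻¹ ≤ k := by
          refine (add_le_add le_rfl (Nat.le_ceil _)).trans ?_
          exact_mod_cast hcon
        have h3 : α * (i + α⁻¹) ≤ α * k := mul_le_mul_of_nonneg_left h2 hα.le
        rw [mul_add, mul_inv_cancel₀ hα.ne'] at h3
        linarith
      omega
    simpa using Finset.card_le_card hsub

lemma lk_eq_or {α t : ℝ} (hα : 0 ≤ α) (ht : t ∈ Set.Ico (0 : ℝ) 1) (k : ℕ) :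
    lk α t k = lk α 0 k ∨ lk α t k = lk α 1 k := by
  have h1 : lk α 1 k = lk α 0 k + 1 := by
    rw [lk_eq_floor, lk_eq_floor, ← Nat.floor_add_one (by positivity)]
    congr 1; ring
  have h2 : lk α 0 k ≤ lk α t k := by
    rw [lk_eq_floor, lk_eq_floor]
    exact Nat.floor_le_floor (by linarith [ht.1])
  have h3 : lk α t k ≤ lk α 1 k := by
    rw [lk_eq_floor, lk_eq_floor]
    exact Nat.floor_le_floor (by linarith [ht.2])
  omega

lemma shiftZ_iterate_apply {A : Type*} (n : ℕ) (ω : ℤ → A) (i : ℤ) :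
    (shiftZ^[n] ω) i = ω (i + n) := by
  induction n generalizing ω with
  | zero => simp
  | succ n ih =>
    rw [Function.iterate_succ_apply, ih]
    simp only [shiftZ]
    congr 1
    push_cast
    ring

lemma FalgZ_mono [MeasurableSpace Λ] {S S' : Set ℤ} (h : S ⊆ S') :
    (FalgZ S : MeasurableSpace (ℤ → Λ × Λ')) ≤ FalgZ S' :=
  biSup_mono h

lemma GalgZ_mono [MeasurableSpace Λ'] {S S' : Set ℤ} (h : S ⊆ S') :
    (GalgZ S : MeasurableSpace (ℤ → Λ × Λ')) ≤ GalgZ S' :=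
  biSup_mono h

variable [MeasurableSpace Λ] [MeasurableSpace Λ']

lemma FalgZ_le (S : Set ℤ) : (FalgZ S : MeasurableSpace (ℤ → Λ × Λ')) ≤ MeasurableSpace.pi :=
  iSup₂_le fun r _ => (measurable_fst.comp (measurable_pi_apply r)).comap_le

lemma GalgZ_le (S : Set ℤ) : (GalgZ S : MeasurableSpace (ℤ → Λ × Λ')) ≤ MeasurableSpace.pi :=
  iSup₂_le fun r _ => (measurable_snd.comp (measurable_pi_apply r)).comap_le

/-- The σ-algebra `𝓕_{-l+1}^s ∨ 𝓖_{-l+1}^0`. -/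
def blockAlg (l s : ℕ) : MeasurableSpace (ℤ → Λ × Λ') :=
  FalgZ (Set.Icc (-(l : ℤ) + 1) (s : ℤ)) ⊔ GalgZ (Set.Icc (-(l : ℤ) + 1) 0)

lemma blockAlg_mono {l l' s s' : ℕ} (hl : l ≤ l') (hs : s ≤ s') :
    (blockAlg l s : MeasurableSpace (ℤ → Λ × Λ')) ≤ blockAlg l' s' :=
  sup_le_sup (FalgZ_mono (Set.Icc_subset_Icc (by omega) (by omega)))
    (GalgZ_mono (Set.Icc_subset_Icc (by omega) le_rfl))

lemma blockAlg_le (l s : ℕ) :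
    (blockAlg l s : MeasurableSpace (ℤ → Λ × Λ')) ≤ MeasurableSpace.pi :=
  sup_le (FalgZ_le _) (GalgZ_le _)

/-- The filtration formed by the block σ-algebras along monotone endpoints. -/
def blockFiltration {l s : ℕ → ℕ} (hl : Monotone l) (hs : Monotone s) :
    Filtration ℕ (MeasurableSpace.pi : MeasurableSpace (ℤ → Λ × Λ')) where
  seq k := blockAlg (l k) (s k)
  mono' _ _ h := blockAlg_mono (hl h) (hs h)
  le' _ := blockAlg_le _ _

lemma measurable_fst_apply_blockAlg {l s : ℕ} {r : ℤ} (hr : r ∈ Set.Icc (-(l : ℤ) + 1) (s : ℤ)) :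
    Measurable[blockAlg l s] fun ω : ℤ → Λ × Λ' => (ω r).1 := by
  refine Measurable.of_comap_le ?_
  exact (le_iSup₂_of_le (f := fun (r : ℤ) (_ : r ∈ Set.Icc (-(l : ℤ) + 1) (s : ℤ)) =>
    MeasurableSpace.comap (fun ω : ℤ → Λ × Λ' => (ω r).1) inferInstance) r hr le_rfl).trans
    le_sup_left

lemma measurableSet_AbarZ_shift [DiscreteMeasurableSpace Λ] (a : List Λ) (l s : ℕ) :
    MeasurableSet[blockAlg l (s + a.length)]
      {ω : ℤ → Λ × Λ' | shiftZ^[s] ω ∈ (AbarZ a : Set (ℤ → Λ × Λ'))} := by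
  have : {ω : ℤ → Λ × Λ' | shiftZ^[s] ω ∈ (AbarZ a : Set (ℤ → Λ × Λ'))} =
      ⋂ j : Fin a.length, (fun ω : ℤ → Λ × Λ' => (ω ((j : ℕ) + 1 + s : ℤ)).1) ⁻¹' {a.get j} := by
    ext ω
    simp [AbarZ, shiftZ_iterate_apply]
  rw [this]
  refine MeasurableSet.iInter fun j => ?_
  refine measurable_fst_apply_blockAlg (Λ' := Λ') ⟨?_, ?_⟩ (measurableSet_singleton _)
  · omega
  · have := j.2
    push_cast
    omega

lemma measurableSet_BbarZ [DiscreteMeasurableSpace Λ'] (b : List Λ') :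
    MeasurableSet (BbarZ b : Set (ℤ → Λ × Λ')) := by
  have : (BbarZ b : Set (ℤ → Λ × Λ')) =
      ⋂ j : Fin b.length, (fun ω : ℤ → Λ × Λ' => (ω ((j : ℕ) + 1 : ℤ)).2) ⁻¹' {b.get j} := by
    ext ω
    simp [BbarZ]
  rw [this]
  exact MeasurableSet.iInter fun j =>
    (measurable_snd.comp (measurable_pi_apply _)) (measurableSet_singleton _)

lemma abs_indicator_one_le_one {Ω : Type*} (s : Set Ω) (ω : Ω) :
    |s.indicator (1 : Ω → ℝ) ω| ≤ 1 := by
  by_cases h : ω ∈ s <;> simp [h]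

/-- The conclusion for a fixed phase `t`. -/
lemma tendsto_average_abs_Ftk_sub_Ctk [DiscreteMeasurableSpace Λ] [DiscreteMeasurableSpace Λ']
    {μ : Measure (ℤ → Λ × Λ')} [IsProbabilityMeasure μ] (hT : MeasurePreserving shiftZ μ μ)
    {α t : ℝ} (hα : α ∈ Set.Ioo (0 : ℝ) 1) (ht : t ∈ Set.Icc (0 : ℝ) 1)
    (a : List Λ) (b : List Λ') :
    ∀ᵐ ω ∂μ, Tendsto (fun N : ℕ => (N : ℝ)⁻¹ * ∑ k ∈ Finset.Icc 1 N,
      |Ftk μ α t k a b (shiftZ^[lk α t k] ω) - Ctk μ α t k a b (shiftZ^[lk α t k] ω)|)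
        atTop (𝓝 0) := by
  have hl : Monotone (lk α t) := lk_mono hα.1.le t
  have hs : Monotone (sk α t) := sk_mono hα.1.le hα.2.le ht.1
  have hs' : Monotone fun k => sk α t k + a.length := fun i j h => Nat.add_le_add_right (hs h) _
  let ℱ : Filtration ℕ (MeasurableSpace.pi : MeasurableSpace (ℤ → Λ × Λ')) :=
    blockFiltration hl hs
  let 𝒢 : Filtration ℕ (MeasurableSpace.pi : MeasurableSpace (ℤ → Λ × Λ')) :=
    blockFiltration hl hs'
  let f : ℕ → (ℤ → Λ × Λ') → ℝ := fun k ω =>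
    Set.indicator (AbarZ a) (1 : (ℤ → Λ × Λ') → ℝ) (shiftZ^[sk α t k] ω)
  let g : (ℤ → Λ × Λ') → ℝ := Set.indicator (BbarZ b) 1
  have hle : ∀ k, ℱ k ≤ 𝒢 k := fun k => blockAlg_mono le_rfl (Nat.le_add_right _ _)
  have hsup : ⨆ k, ℱ k = ⨆ k, 𝒢 k := by
    refine le_antisymm (iSup_mono hle) (iSup_le fun k => ?_)
    obtain ⟨i, hi, hki⟩ := ((tendsto_sk hα.1.le hα.2 ht.1).eventually_ge_atTop
      (sk α t k + a.length)).and (eventually_ge_atTop k) |>.exists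
    exact (blockAlg_mono (hl hki) hi).trans (le_iSup ℱ i)
  have hf : ∀ k, StronglyMeasurable[𝒢 k] (f k) := fun k =>
    (@stronglyMeasurable_one _ _ (𝒢 k) _ _).indicator (measurableSet_AbarZ_shift a _ _)
  have hf1 : ∀ k ω, |f k ω| ≤ 1 := fun k ω => abs_indicator_one_le_one _ _
  have hg : Measurable g := measurable_one.indicator (measurableSet_BbarZ b)
  have hg1 : ∀ ω, |g ω| ≤ 1 := fun ω => abs_indicator_one_le_one _ _
  have hfg1 : ∀ k ω, |(f k * g) ω| ≤ 1 := fun k ω => by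
    rw [Pi.mul_apply, abs_mul]
    exact mul_le_one₀ (hf1 k ω) (abs_nonneg _) (hg1 ω)
  have hmeas : ∀ k (h : (ℤ → Λ × Λ') → ℝ), Measurable (μ[h | ℱ k]) := fun k h =>
    (stronglyMeasurable_condExp.mono (ℱ.le k)).measurable
  refine tendsto_average_comp_iterate (R := 2) hT
    (D := fun k ω => |(μ[f k * g | ℱ k]) ω - (μ[f k | ℱ k]) ω * (μ[g | ℱ k]) ω|)
    (fun k => ((hmeas k _).sub ((hmeas k _).mul (hmeas k _))).abs)
    (fun k ω => abs_nonneg _) (fun k => ?_)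
    (tendsto_condExp_mul_sub ℱ 𝒢 hle hsup hf hf1 hg hg1)
    (lk_le hα.2.le ht.2) (card_lk_fiber_le hα.1 ht.1)
  filter_upwards [abs_condExp_le_one (m := ℱ k) (μ := μ) (hfg1 k),
    abs_condExp_le_one (m := ℱ k) (μ := μ) (hf1 k),
    abs_condExp_le_one (m := ℱ k) (μ := μ) hg1] with ω h1 h2 h3
  refine (abs_sub _ _).trans ?_
  rw [abs_mul]
  linarith [mul_le_one₀ h2 (abs_nonneg _) h3]

end Symbolic

theorem stmt13 {Λ Λ' : Type*} [Fintype Λ] [Fintype Λ']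
    [MeasurableSpace Λ] [DiscreteMeasurableSpace Λ]
    [MeasurableSpace Λ'] [DiscreteMeasurableSpace Λ']
    (μ : Measure (ℤ → Λ × Λ')) [IsProbabilityMeasure μ]
    (hinv : μ.map shiftZ = μ)
    (hT : MeasurePreserving shiftZ μ μ) (hwm : WeakMixing shiftZ μ)
    (α : ℝ) (hα : Irrational α) (hα01 : α ∈ Set.Ioo (0 : ℝ) 1)
    (a : List Λ) (b : List Λ') :
    ∃ Ω' : Set (ℤ → Λ × Λ'), μ Ω' = 1 ∧ ∀ ω ∈ Ω', ∀ t ∈ Set.Ico (0 : ℝ) 1,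
      Tendsto (fun N : ℕ => (N : ℝ)⁻¹ *
          ∑ k ∈ Finset.Icc 1 N,
            |Ftk μ α t k a b (shiftZ^[lk α t k] ω) - Ctk μ α t k a b (shiftZ^[lk α t k] ω)|)
        atTop (𝓝 0) := by
  have h0 := tendsto_average_abs_Ftk_sub_Ctk hT hα01 (t := 0) ⟨le_rfl, zero_le_one⟩ a b
  have h1 := tendsto_average_abs_Ftk_sub_Ctk hT hα01 (t := 1) ⟨zero_le_one, le_rfl⟩ a b
  refine ⟨_, (measure_congr (eventuallyEq_univ.2 (h0.and h1))).trans measure_univ, ?_⟩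
  rintro ω ⟨hω0, hω1⟩ t ht
  have hsum := hω0.add hω1
  rw [add_zero] at hsum
  refine squeeze_zero (fun N => by positivity) (fun N => ?_) hsum
  rw [← mul_add, ← Finset.sum_add_distrib]
  refine mul_le_mul_of_nonneg_left (Finset.sum_le_sum fun k _ => ?_) (by positivity)
  have hcongr : ∀ t', lk α t k = lk α t' k →
      |Ftk μ α t k a b (shiftZ^[lk α t k] ω) - Ctk μ α t k a b (shiftZ^[lk α t k] ω)| =
      |Ftk μ α t' k a b (shiftZ^[lk α t' k] ω) - Ctk μ α t' k a b (shiftZ^[lk α t' k] ω)| := by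
    intro t' h
    simp only [Ftk, Ctk, Htk, sk, h]
  rcases lk_eq_or hα01.1.le ht k with h | h
  · rw [hcongr 0 h]
    exact le_add_of_nonneg_right (abs_nonneg _)
  · rw [hcongr 1 h]
    exact le_add_of_nonneg_left (abs_nonneg _)
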